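/- For each fixed m ≥ 1, f_m(n) is a quasi-polynomial in n of degree m-1 for n sufficiently large; that is, there exists a period N and polynomials P_0,...,P_{N-1} of degree at most m-1, at least one of degree exactly m-1, such that f_m(n) = P_{n mod N}(n) for all large n. -/

import Mathlib

/-- A partition has pairwise distinct (nonzero) multiplicities. -/
def distinctMult {n : ℕ} (P : n.Partition) : Prop :=
  ∀ i ∈ P.parts, ∀ j ∈ P.parts, i ≠ j → P.parts.count i ≠ P.parts.count j

/-- `fm m n` : the number of partitions of `n` with all parts at most `m` and all nonzero
multiplicities pairwise distinct. -/
noncomputable def fm (m n : ℕ) : ℕ :=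
  Nat.card {P : n.Partition // (∀ x ∈ P.parts, x ≤ m) ∧ distinctMult P}

open Polynomial in
lemma taylor_top (p : ℚ[X]) (k : ℕ) (a : ℚ) (h : p.natDegree ≤ k) :
    (taylor a p).coeff k = p.coeff k := by
  rw [taylor_coeff]
  have h1 : (hasseDeriv k p).natDegree ≤ 0 := (natDegree_hasseDeriv_le p k).trans (by omega)
  rw [eq_C_of_natDegree_le_zero h1]
  simp [hasseDeriv_coeff]

open Polynomial in
lemma taylor_sub (p : ℚ[X]) (k : ℕ) (a : ℚ) (h : p.natDegree ≤ k + 1) :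
    (taylor a p).coeff k = p.coeff k + (k + 1) * a * p.coeff (k + 1) := by
  rw [taylor_coeff]
  have h1 : (hasseDeriv k p).natDegree ≤ 1 := (natDegree_hasseDeriv_le p k).trans (by omega)
  rw [eq_X_add_C_of_natDegree_le_one h1]
  simp only [hasseDeriv_coeff, eval_add, eval_mul, eval_C, eval_X]
  simp [add_comm 1 k]
  ring

open Polynomial in
lemma natDegree_le_of_top (p : ℚ[X]) (k : ℕ) (h : p.natDegree ≤ k + 1) (h0 : p.coeff (k+1) = 0) :
    p.natDegree ≤ k := by
  rw [natDegree_le_iff_coeff_eq_zero] at h ⊢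
  intro n hn
  rcases Nat.lt_or_ge (k+1) n with h1 | h1
  · exact h n h1
  · have : n = k + 1 := by omega
    rw [this, h0]

open Polynomial in
lemma antidiff (N : ℚ) (hN : N ≠ 0) (k : ℕ) : ∀ R : ℚ[X], R.natDegree ≤ k →
    ∃ T : ℚ[X], T.natDegree ≤ k + 1 ∧ T.coeff (k+1) = R.coeff k / (N * (k+1)) ∧
      taylor N T - T = R := by
  induction k with
  | zero =>
    intro R hR
    rw [eq_C_of_natDegree_le_zero hR]
    refine ⟨C (R.coeff 0 / N) * X, ?_, ?_, ?_⟩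
    · exact (natDegree_C_mul_le _ _).trans (by simp)
    · simp
    · rw [taylor_apply]
      simp only [mul_comp, C_comp, X_comp]
      rw [mul_add, add_sub_cancel_left, ← C_mul]
      congr 1
      field_simp
  | succ k ih =>
    intro R hR
    set a : ℚ := R.coeff (k+1) / (N * ((k+1 : ℕ) + 1)) with ha
    set T0 : ℚ[X] := C a * X ^ (k + 1 + 1) with hT0
    have hd0 : T0.natDegree ≤ k + 1 + 1 := natDegree_C_mul_X_pow_le _ _
    have hc0 : T0.coeff (k+1+1) = a := by simp [hT0]
    have hc1 : T0.coeff (k+1) = 0 := by simp [hT0]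
    have hk : ((k+1 : ℕ) : ℚ) + 1 ≠ 0 := by positivity
    have hD : (R - (taylor N T0 - T0)).natDegree ≤ k := by
      have e1 : (taylor N T0 - T0).natDegree ≤ k + 1 := by
        apply natDegree_le_of_top
        · refine (natDegree_sub_le _ _).trans ?_
          rw [natDegree_taylor]; simpa using hd0
        · rw [coeff_sub, taylor_top _ _ _ hd0, sub_self]
      apply natDegree_le_of_top
      · exact (natDegree_sub_le _ _).trans (by simp; exact ⟨hR, e1⟩)
      · rw [coeff_sub, coeff_sub, taylor_sub _ _ _ hd0, hc0, hc1, ha]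
        field_simp
        ring
    obtain ⟨T1, h1, h2, h3⟩ := ih _ hD
    refine ⟨T0 + T1, ?_, ?_, ?_⟩
    · exact (natDegree_add_le _ _).trans (by simp; exact ⟨hd0, by omega⟩)
    · rw [coeff_add, hc0, coeff_eq_zero_of_natDegree_lt (p := T1) (by omega), add_zero]
    · rw [map_add]
      linear_combination h3

open Polynomial in
/-- Eventually quasi-polynomial with period `N`, degree at most `k`, and constant coefficient
`α` in degree `k`. -/
def QP (N k : ℕ) (α : ℚ) (f : ℕ → ℚ) : Prop :=
  ∃ P : ℕ → ℚ[X], (∀ r, (P r).natDegree ≤ k) ∧ (∀ r, (P r).coeff k = α) ∧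
    ∃ n₀ : ℕ, ∀ n ≥ n₀, f n = (P (n % N)).eval (n : ℚ)

open Polynomial in
lemma QP.raise {N k : ℕ} {α : ℚ} {f : ℕ → ℚ} (h : QP N k α f) (k' : ℕ) (hk : k < k') :
    QP N k' 0 f := by
  obtain ⟨P, h1, h2, h3⟩ := h
  exact ⟨P, fun r => (h1 r).trans hk.le,
    fun r => coeff_eq_zero_of_natDegree_lt ((h1 r).trans_lt hk), h3⟩

open Polynomial in
lemma QP.sum {ι : Type*} {N k : ℕ} (s : Finset ι) (α : ι → ℚ) (f : ι → ℕ → ℚ)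
    (h : ∀ i ∈ s, QP N k (α i) (f i)) : QP N k (∑ i ∈ s, α i) (fun n => ∑ i ∈ s, f i n) := by
  classical
  induction s using Finset.induction_on with
  | empty => exact ⟨fun _ => 0, by simp, by simp, 0, by simp⟩
  | insert a s ha ih =>
    obtain ⟨P, h1, h2, n1, h3⟩ := h a (by simp)
    obtain ⟨Q, g1, g2, n2, g3⟩ := ih (fun i hi => h i (by simp [hi]))
    refine ⟨fun r => P r + Q r, ?_, ?_, max n1 n2, ?_⟩
    · intro r
      exact (natDegree_add_le _ _).trans (by simp; exact ⟨h1 r, g1 r⟩)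
    · intro r
      rw [coeff_add, h2, g2, Finset.sum_insert ha]
    · intro n hn
      have g := g3 n (by omega)
      beta_reduce at g ⊢
      rw [Finset.sum_insert ha, h3 n (by omega), g, eval_add]

open Polynomial in
lemma QP.step {N k c : ℕ} {α : ℚ} {f h : ℕ → ℚ} (hN : 0 < N) (hc : 0 < c) (hcN : c ∣ N)
    (hh : QP N k α h) (hf : ∀ n, f (n + c) = f n + h n) :
    QP N (k+1) (α / (c * (k+1))) f := by
  obtain ⟨Q, h1, h2, n0, h3⟩ := hh
  obtain ⟨q, rfl⟩ := hcN
  have hq : 0 < q := Nat.pos_of_mul_pos_left hN |> fun _ => by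
    rcases Nat.eq_zero_or_pos q with h | h
    · simp [h] at hN
    · exact h
  have hcq : (c : ℚ) ≠ 0 := by positivity
  have hqq : (q : ℚ) ≠ 0 := by positivity
  set N := c * q with hNdef
  have hsum : ∀ j n, f (n + c * j) = f n + ∑ t ∈ Finset.range j, h (n + c * t) := by
    intro j n
    induction j with
    | zero => simp
    | succ j ih => rw [Finset.sum_range_succ, ← add_assoc, ← ih, ← hf]; congr 1; ring
  let R : ℕ → ℚ[X] := fun r =>
    ∑ t ∈ Finset.range q, taylor ((c * t : ℕ) : ℚ) (Q ((r + c * t) % N))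
  have hRd : ∀ r, (R r).natDegree ≤ k := fun r => by
    apply natDegree_sum_le_of_forall_le
    intro t _
    rw [natDegree_taylor]; exact h1 _
  have hRc : ∀ r, (R r).coeff k = q * α := fun r => by
    simp only [R, finsetSum_coeff]
    rw [Finset.sum_congr rfl (fun t _ => by rw [taylor_top _ _ _ (h1 _), h2])]
    simp
  have hR : ∀ n ≥ n0, f (n + N) = f n + (R (n % N)).eval (n : ℚ) := by
    intro n hn
    rw [hNdef, hsum]
    congr 1
    simp only [R, eval_finsetSum]
    refine Finset.sum_congr rfl fun t _ => ?_
    rw [h3 _ (by omega), taylor_eval, Nat.mod_add_mod]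
    push_cast
    rfl
  have hNq : (N : ℚ) ≠ 0 := by positivity
  choose T hT1 hT2 hT3 using fun r => antidiff (N : ℚ) hNq k (R r) (hRd r)
  refine ⟨fun r => T r + C (f (r + N * n0) - (T r).eval ((r + N * n0 : ℕ) : ℚ)), ?_, ?_,
    N * n0 + N, ?_⟩
  · intro r
    exact (natDegree_add_le _ _).trans (by simp; exact hT1 r)
  · intro r
    rw [coeff_add, hT2, hRc, coeff_C_of_ne_zero (by omega), hNdef]
    push_cast
    field_simp
    simp
  · intro n hn
    have key : ∀ r < N, ∀ j, f (r + N * (n0 + j)) = (T r).eval ((r + N * (n0 + j) : ℕ) : ℚ)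
        + (f (r + N * n0) - (T r).eval ((r + N * n0 : ℕ) : ℚ)) := by
      intro r hr j
      induction j with
      | zero => simp
      | succ j ih =>
        have e : r + N * (n0 + (j + 1)) = (r + N * (n0 + j)) + N := by ring
        have hge : n0 ≤ r + N * (n0 + j) := by nlinarith
        rw [e, hR _ hge, ih]
        have hm : (r + N * (n0 + j)) % N = r := by
          rw [Nat.add_mul_mod_self_left, Nat.mod_eq_of_lt hr]
        rw [hm]
        have := congrArg (eval ((r + N * (n0 + j) : ℕ) : ℚ)) (hT3 r)
        rw [eval_sub, taylor_eval] at this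
        rw [← this]
        push_cast
        ring_nf
    have hdm := Nat.mod_add_div n N
    have hle : n0 ≤ n / N := by
      rw [Nat.le_div_iff_mul_le hN]; nlinarith
    have := key (n % N) (Nat.mod_lt _ hN) (n / N - n0)
    rw [Nat.add_sub_cancel' hle, hdm] at this
    rw [this]
    simp

/-- Multisets of positive naturals with sum `n`. -/
def MS (n : ℕ) : Finset (Multiset ℕ) :=
  (Finset.univ : Finset n.Partition).image Nat.Partition.parts

lemma mem_MS {n : ℕ} {M : Multiset ℕ} : M ∈ MS n ↔ (∀ i ∈ M, 0 < i) ∧ M.sum = n := by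
  simp only [MS, Finset.mem_image, Finset.mem_univ, true_and]
  constructor
  · rintro ⟨P, rfl⟩
    exact ⟨fun i hi => P.parts_pos hi, P.parts_sum⟩
  · rintro ⟨h1, h2⟩
    exact ⟨⟨M, fun {i} hi => h1 i hi, h2⟩, rfl⟩

/-- Distinct multiplicities, on multisets. -/
def DM (M : Multiset ℕ) : Prop := ∀ i ∈ M, ∀ j ∈ M, i ≠ j → M.count i ≠ M.count j

open Classical in
/-- Number of multisets with support `S`, sum `n` and distinct multiplicities. -/
noncomputable def GS (S : Finset ℕ) (n : ℕ) : ℕ :=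
  ((MS n).filter (fun M => M.toFinset = S ∧ DM M)).card

open Classical in
lemma fm_eq (m n : ℕ) : fm m n = ∑ S ∈ (Finset.Icc 1 m).powerset, GS S n := by
  have h1 : fm m n = ((MS n).filter (fun M => (∀ x ∈ M, x ≤ m) ∧ DM M)).card := by
    rw [fm, Nat.card_eq_fintype_card, Fintype.card_subtype]
    have hinj : Function.Injective (Nat.Partition.parts (n := n)) :=
      fun a b h => Nat.Partition.ext h
    rw [MS, Finset.filter_image, Finset.card_image_of_injective _ hinj]
    rfl
  rw [h1, Finset.card_eq_sum_card_fiberwise (f := Multiset.toFinset)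
    (t := (Finset.Icc 1 m).powerset)]
  · refine Finset.sum_congr rfl fun S hS => ?_
    rw [GS, Finset.filter_filter]
    congr 1
    apply Finset.filter_congr
    intro M hM
    constructor
    · rintro ⟨⟨_, h⟩, h'⟩; exact ⟨h', h⟩
    · rintro ⟨h, h'⟩
      refine ⟨⟨fun x hx => ?_, h'⟩, h⟩
      have : x ∈ S := by rw [← h]; simpa using hx
      exact (Finset.mem_Icc.1 (Finset.mem_powerset.1 hS this)).2
  · intro M hM
    simp only [Finset.coe_filter, Set.mem_ofPred_eq, mem_MS] at hM
    simp only [Finset.coe_powerset, Set.mem_preimage, Set.mem_powerset_iff]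
    intro x hx
    have hx' : x ∈ M := by simpa using hx
    simp only [Finset.coe_Icc, Set.mem_Icc]
    exact ⟨hM.1.1 x hx', hM.2.1 x hx'⟩

lemma count_add_val (S : Finset ℕ) (M : Multiset ℕ) (i : ℕ) :
    (M + S.val).count i = M.count i + if i ∈ S then 1 else 0 := by
  rw [Multiset.count_add]
  congr 1
  split_ifs with h
  · exact Multiset.count_eq_one_of_mem S.nodup h
  · exact Multiset.count_eq_zero_of_notMem h

lemma toFinset_val_le (M : Multiset ℕ) : M.toFinset.val ≤ M := by
  rw [Multiset.toFinset_val]; exact Multiset.dedup_le M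

lemma sum_val (S : Finset ℕ) : S.val.sum = ∑ i ∈ S, i := by
  simp only [Finset.sum, Multiset.map_id']

open Classical in
lemma GS_shift (S : Finset ℕ) (hS : 0 ∉ S) (n : ℕ) :
    GS S (n + ∑ i ∈ S, i) =
      ((MS n).filter (fun M => M.toFinset ⊆ S ∧ Set.InjOn (fun i => M.count i) S)).card := by
  symm
  rw [GS]
  refine Finset.card_bij (fun M _ => M + S.val) ?_ ?_ ?_
  · intro M hM
    simp only [Finset.mem_filter, mem_MS] at hM ⊢
    obtain ⟨⟨hp, hs⟩, hsub, hinj⟩ := hM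
    have htf : (M + S.val).toFinset = S := by
      ext x
      simp only [Multiset.toFinset_add, Finset.mem_union, Finset.val_toFinset]
      exact ⟨fun h => h.elim (fun h => hsub h) id, Or.inr⟩
    have hmem : ∀ x, x ∈ M + S.val ↔ x ∈ S := fun x => by rw [← Multiset.mem_toFinset, htf]
    refine ⟨⟨?_, ?_⟩, htf, ?_⟩
    · intro i hi
      rw [hmem] at hi
      exact Nat.pos_of_ne_zero fun h => hS (h ▸ hi)
    · rw [Multiset.sum_add, hs, sum_val]
    · intro i hi j hj hij
      rw [hmem] at hi hj
      rw [count_add_val, count_add_val, if_pos hi, if_pos hj]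
      intro h
      exact hij (hinj hi hj (by simpa using h))
  · intro a _ b _ h
    exact add_right_cancel h
  · intro M hM
    simp only [Finset.mem_filter, mem_MS] at hM
    obtain ⟨⟨hp, hs⟩, htf, hd⟩ := hM
    obtain ⟨L, hL⟩ := Multiset.le_iff_exists_add.1 (htf ▸ toFinset_val_le M)
    rw [add_comm] at hL
    refine ⟨L, ?_, hL.symm⟩
    have hmem : ∀ x, x ∈ M ↔ x ∈ S := fun x => by rw [← Multiset.mem_toFinset, htf]
    have hLM : ∀ x ∈ L, x ∈ M := fun x hx => by rw [hL]; exact Multiset.mem_add.2 (Or.inl hx)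
    simp only [Finset.mem_filter, mem_MS]
    refine ⟨⟨fun i hi => hp i (hLM i hi), ?_⟩, ?_, ?_⟩
    · rw [hL, Multiset.sum_add, sum_val] at hs; omega
    · intro x hx
      exact (hmem x).1 (hLM x (by simpa using hx))
    · intro i hi j hj hij
      by_contra hne
      refine hd i ((hmem i).2 hi) j ((hmem j).2 hj) hne ?_
      rw [hL, count_add_val, count_add_val, if_pos (Finset.mem_coe.1 hi),
        if_pos (Finset.mem_coe.1 hj)]
      simpa using hij

open Classical in
lemma GS_rec (S : Finset ℕ) (hS : 0 ∉ S) (n : ℕ) :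
    GS S (n + ∑ i ∈ S, i) = GS S n + ∑ i ∈ S, GS (S.erase i) n := by
  rw [GS_shift S hS, Finset.card_eq_sum_card_fiberwise (f := Multiset.toFinset)
    (t := insert S (S.image S.erase)), Finset.sum_insert, Finset.sum_image]
  · congr 1
    · rw [GS, Finset.filter_filter]
      congr 1
      apply Finset.filter_congr
      intro M hM
      constructor
      · rintro ⟨⟨h1, h2⟩, h3⟩
        refine ⟨h3, fun i hi j hj hij h => hij (h2 ?_ ?_ h)⟩
        · rw [← h3]; simpa using hi
        · rw [← h3]; simpa using hj
      · rintro ⟨h3, h2⟩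
        refine ⟨⟨h3.subset, fun i hi j hj h => ?_⟩, h3⟩
        by_contra hne
        rw [← h3] at hi hj
        exact h2 i (by simpa using hi) j (by simpa using hj) hne h
    · refine Finset.sum_congr rfl fun a ha => ?_
      rw [GS, Finset.filter_filter]
      congr 1
      apply Finset.filter_congr
      intro M hM
      constructor
      · rintro ⟨⟨h1, h2⟩, h3⟩
        exact ⟨h3, fun i hi j hj hij h =>
          hij (h2 (h1 (by simpa using hi)) (h1 (by simpa using hj)) h)⟩
      · rintro ⟨h3, h2⟩
        have hmem : ∀ x, x ∈ M ↔ x ≠ a ∧ x ∈ S := fun x => by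
          rw [← Multiset.mem_toFinset, h3, Finset.mem_erase]
        refine ⟨⟨h3.subset.trans (Finset.erase_subset _ _), fun i hi j hj h => ?_⟩, h3⟩
        have hz : ∀ x ∈ S, M.count x = 0 → x = a := fun x hx h0 => by
          by_contra hne
          exact (Multiset.count_eq_zero.1 h0) ((hmem x).2 ⟨hne, hx⟩)
        have ha0 : M.count a = 0 := Multiset.count_eq_zero.2 fun h => ((hmem a).1 h).1 rfl
        by_contra hne
        simp only at h
        by_cases hia : i = a
        · subst hia
          exact hne (hz j hj (by rw [← h, ha0])).symm
        · by_cases hja : j = a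
          · subst hja
            exact hia (hz i hi (by rw [h, ha0]))
          · exact h2 i ((hmem i).2 ⟨hia, hi⟩) j ((hmem j).2 ⟨hja, hj⟩) hne h
  · intro a ha b hb h
    exact (Finset.erase_inj S ha).1 h
  · intro h
    obtain ⟨a, ha, he⟩ := Finset.mem_image.1 h
    rw [← he] at ha
    have : a ∈ S.erase a := by rw [he]; rw [← he]; exact ha
    simp at this
  · intro M hM
    simp only [Finset.coe_filter, Set.mem_ofPred_eq] at hM
    obtain ⟨hM, hsub, hinj⟩ := hM
    simp only [Finset.coe_insert, Finset.coe_image]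
    by_cases h : M.toFinset = S
    · exact Or.inl h
    · right
      obtain ⟨a, ha, hna⟩ := Finset.exists_of_ssubset (Finset.ssubset_iff_subset_ne.2 ⟨hsub, h⟩)
      refine ⟨a, ha, ?_⟩
      ext x
      rw [Finset.mem_erase]
      constructor
      · rintro ⟨hxa, hx⟩
        by_contra hxM
        refine hxa (hinj hx ha ?_)
        simp only [Multiset.mem_toFinset] at hna hxM
        simp [Multiset.count_eq_zero.2 hna, Multiset.count_eq_zero.2 hxM]
      · intro hx
        exact ⟨fun h => hna (h ▸ hx), hsub hx⟩

lemma GS_small (S : Finset ℕ) (n : ℕ) (hn : n < ∑ i ∈ S, i) : GS S n = 0 := by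
  classical
  rw [GS, Finset.card_eq_zero, Finset.filter_eq_empty_iff]
  rintro M hM ⟨h, -⟩
  obtain ⟨L, hL⟩ := Multiset.le_iff_exists_add.1 (h ▸ toFinset_val_le M)
  have := (mem_MS.1 hM).2
  rw [hL, Multiset.sum_add, sum_val] at this
  omega

lemma GS_empty (n : ℕ) : GS ∅ n = if n = 0 then 1 else 0 := by
  classical
  rw [GS]
  split_ifs with h
  · subst h
    rw [Finset.card_eq_one]
    refine ⟨0, ?_⟩
    ext M
    simp only [Finset.mem_filter, mem_MS, Finset.mem_singleton, Multiset.toFinset_eq_empty]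
    constructor
    · rintro ⟨_, h, _⟩; exact h
    · rintro rfl; simp [DM]
  · rw [Finset.card_eq_zero, Finset.filter_eq_empty_iff]
    rintro M hM ⟨h1, -⟩
    rw [Multiset.toFinset_eq_empty] at h1
    subst h1
    have := (mem_MS.1 hM).2
    simp at this
    omega

/-- Summatory function. -/
noncomputable def AS (S : Finset ℕ) (x : ℕ) : ℚ := ∑ n ∈ Finset.range x, (GS S n : ℚ)

lemma AS_rec (S : Finset ℕ) (hS : 0 ∉ S) (x : ℕ) :
    AS S (x + ∑ i ∈ S, i) = AS S x + ∑ i ∈ S, AS (S.erase i) x := by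
  simp only [AS]
  rw [add_comm x, Finset.sum_range_add, Finset.sum_eq_zero (s := Finset.range (∑ i ∈ S, i)),
    zero_add, Finset.sum_comm, ← Finset.sum_add_distrib]
  · refine Finset.sum_congr rfl fun n _ => ?_
    rw [add_comm, GS_rec S hS]
    push_cast
    rfl
  · intro n hn
    rw [GS_small S n (Finset.mem_range.1 hn)]
    simp

lemma AS_qp (m N : ℕ) (hN : 0 < N) (hd : ∀ c, 0 < c → c ≤ ∑ i ∈ Finset.Icc 1 m, i → c ∣ N) :
    ∀ k, ∀ S ⊆ Finset.Icc 1 m, S.card = k → ∃ α : ℚ, 0 < α ∧ QP N k α (AS S) := by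
  intro k
  induction k with
  | zero =>
    intro S _ hS
    rw [Finset.card_eq_zero] at hS
    subst hS
    refine ⟨1, one_pos, fun _ => 1, by simp, by simp, 1, ?_⟩
    intro n hn
    simp only [AS, GS_empty]
    simp
    omega
  | succ k ih =>
    intro S hS hc
    have h0 : 0 ∉ S := fun h => by simpa using hS h
    have hne : S.Nonempty := by rw [← Finset.card_pos]; omega
    have ih' : ∀ i, ∃ α : ℚ, i ∈ S → 0 < α ∧ QP N k α (AS (S.erase i)) := by
      intro i
      by_cases hi : i ∈ S
      · obtain ⟨α, h⟩ := ih (S.erase i) ((Finset.erase_subset _ _).trans hS)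
          (by rw [Finset.card_erase_of_mem hi]; omega)
        exact ⟨α, fun _ => h⟩
      · exact ⟨0, fun h => absurd h hi⟩
    choose α hα using ih'
    have hpos : 0 < ∑ i ∈ S, i := by
      apply Finset.sum_pos _ hne
      intro i hi
      exact Nat.pos_of_ne_zero fun h => h0 (h ▸ hi)
    have hsum : 0 < ∑ i ∈ S, α i := Finset.sum_pos (fun i hi => (hα i hi).1) hne
    refine ⟨_, ?_, QP.step hN hpos (hd _ hpos (Finset.sum_le_sum_of_subset hS))
      (QP.sum S α _ (fun i hi => (hα i hi).2)) (AS_rec S h0)⟩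
    positivity

open Polynomial in
/-- For each fixed `m ≥ 1`, `f_m(n)` is, for large `n`, a quasi-polynomial in `n` of degree
`m-1`: there is a period `N` and polynomials `P_0, …, P_{N-1}` of degree at most `m-1`, at
least one of degree exactly `m-1`, with `f_m(n) = P_{n mod N}(n)` for all large `n`. -/
theorem fm_quasipolynomial (m : ℕ) (hm : 1 ≤ m) :
    ∃ (N : ℕ) (_ : 0 < N) (P : ℕ → Polynomial ℚ) (n₀ : ℕ),
      (∀ r < N, (P r).degree ≤ (m - 1 : ℕ)) ∧
      (∃ r < N, (P r).degree = (m - 1 : ℕ)) ∧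
      ∀ n ≥ n₀, (fm m n : ℚ) = (P (n % N)).eval (n : ℚ) := by
  obtain ⟨k, rfl⟩ : ∃ k, m = k + 1 := ⟨m - 1, by omega⟩
  simp only [Nat.add_sub_cancel]
  set m := k + 1 with hmk
  set N := (∑ i ∈ Finset.Icc 1 m, i).factorial with hNdef
  have hN : 0 < N := Nat.factorial_pos _
  have hAS := AS_qp m N hN (fun c h1 h2 => Nat.dvd_factorial h1 h2)
  have h1 : ∀ S, ∃ α : ℚ, S ∈ (Finset.Icc 1 m).powerset →
      0 ≤ α ∧ QP N m α (AS S) ∧ (S = Finset.Icc 1 m → 0 < α) := by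
    intro S
    by_cases hS : S ∈ (Finset.Icc 1 m).powerset
    · have hS' := Finset.mem_powerset.1 hS
      obtain ⟨α, hα, hq⟩ := hAS _ S hS' rfl
      by_cases he : S = Finset.Icc 1 m
      · have : S.card = m := by rw [he]; simp
        rw [this] at hq
        exact ⟨α, fun _ => ⟨hα.le, hq, fun _ => hα⟩⟩
      · have hlt := Finset.card_lt_card (Finset.ssubset_iff_subset_ne.2 ⟨hS', he⟩)
        simp only [Nat.card_Icc, Nat.add_sub_cancel] at hlt
        exact ⟨0, fun _ => ⟨le_rfl, hq.raise m hlt, fun h => absurd h he⟩⟩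
    · exact ⟨0, fun h => absurd h hS⟩
  choose α hα using h1
  have hQ := QP.sum _ α AS (fun S hS => (hα S hS).2.1)
  have hpos : 0 < ∑ S ∈ (Finset.Icc 1 m).powerset, α S :=
    Finset.sum_pos' (fun S hS => (hα S hS).1)
      ⟨Finset.Icc 1 m, by simp, (hα _ (by simp)).2.2 rfl⟩
  set β := ∑ S ∈ (Finset.Icc 1 m).powerset, α S
  obtain ⟨P, hP1, hP2, n0, hP3⟩ := hQ
  let D : ℕ → ℚ[X] := fun r => taylor 1 (P ((r + 1) % N)) - P r
  have hD : ∀ r, (D r).natDegree ≤ k := by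
    intro r
    apply natDegree_le_of_top
    · refine (natDegree_sub_le _ _).trans ?_
      rw [natDegree_taylor]
      exact max_le (hP1 _) (hP1 _)
    · simp only [D]
      rw [coeff_sub, taylor_top _ _ _ (hP1 _), hP2, hP2, sub_self]
  refine ⟨N, hN, D, n0, fun r _ => natDegree_le_iff_degree_le.1 (hD r), ?_, ?_⟩
  · by_contra! hcon
    have hz : ∀ r < N, (D r).coeff k = 0 := by
      intro r hr
      by_contra h
      refine hcon r hr (le_antisymm (natDegree_le_iff_degree_le.1 (hD r)) ?_)
      exact le_degree_of_ne_zero h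
    have htel : ∀ j ≤ N, ∑ t ∈ Finset.range j, taylor (t : ℚ) (D t)
        = taylor (j : ℚ) (P (j % N)) - P 0 := by
      intro j
      induction j with
      | zero => intro _; simp
      | succ j ih =>
        intro hj
        rw [Finset.sum_range_succ, ih (by omega), Nat.mod_eq_of_lt (show j < N by omega)]
        simp only [D, map_sub, taylor_taylor]
        push_cast
        ring_nf
    have h2 := congrArg (fun p => coeff p k) (htel N le_rfl)
    simp only [finsetSum_coeff, coeff_sub, Nat.mod_self] at h2
    rw [Finset.sum_eq_zero, taylor_sub _ _ _ (hP1 _), hP2] at h2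
    · have : 0 < ((k : ℚ) + 1) * N * β := by positivity
      linarith
    · intro t ht
      rw [taylor_top _ _ _ (hD t), hz t (Finset.mem_range.1 ht)]
  · intro n hn
    have e1 := hP3 n hn
    have e2 := hP3 (n+1) (by omega)
    simp only [D, eval_sub, taylor_eval]
    rw [Nat.mod_add_mod, ← e1]
    push_cast at e2
    beta_reduce
    rw [← e2, ← Finset.sum_sub_distrib, fm_eq]
    push_cast
    refine Finset.sum_congr rfl fun S _ => ?_
    simp only [AS, Finset.sum_range_succ]
    ring
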